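/- Let k, n be integers with 2 ≤ k and 4k ≤ n. Suppose there exists λ ∈ ℝ such that for every smooth function g : ℝ^n → ℝ with compact support contained in the open upper half space ℝ^n_+ = {x : x₁ > 0}, one has ∫_{ℝ^n_+} g·((-Δ)^k g) dx + λ ∫_{ℝ^n_+} g(x)²/x₁^{2k} dx ≥ S_{n,k} · (∫_{ℝ^n_+} |g|^{2n/(n-2k)} dx)^{(n-2k)/n}, where S_{n,k} = (Γ((n+2k)/2)/Γ((n-2k)/2)) · ω_n^{2k/n}. Then λ ≥ 0. -/

import Mathlib

open MeasureTheory Real Finset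

/-- The Euclidean Laplacian `Δ f = ∑ ∂²f/∂xᵢ²` on `ℝⁿ`. -/
noncomputable def eucLaplacian {n : ℕ} (f : EuclideanSpace ℝ (Fin n) → ℝ) :
    EuclideanSpace ℝ (Fin n) → ℝ :=
  fun x => ∑ i : Fin n,
    iteratedFDeriv ℝ 2 f x ![EuclideanSpace.single i 1, EuclideanSpace.single i 1]

/-- The k-fold iterate `(-Δ)^k`. -/
noncomputable def negLapPow {n : ℕ} (k : ℕ) (f : EuclideanSpace ℝ (Fin n) → ℝ) :
    EuclideanSpace ℝ (Fin n) → ℝ :=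
  (fun g => fun x => -eucLaplacian g x)^[k] f

/-- The Laplacian of a radial function `x ↦ f (‖x - e‖²)`. -/
theorem eucLaplacian_radial {n : ℕ} {f : ℝ → ℝ} (e x : EuclideanSpace ℝ (Fin n))
    (hf : ∀ᶠ s in nhds (‖x - e‖ ^ 2), DifferentiableAt ℝ f s)
    (hdf : DifferentiableAt ℝ (deriv f) (‖x - e‖ ^ 2)) :
    eucLaplacian (fun y => f (‖y - e‖ ^ 2)) x =
      4 * ‖x - e‖ ^ 2 * deriv (deriv f) (‖x - e‖ ^ 2) + 2 * n * deriv f (‖x - e‖ ^ 2) := by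
  have hq : ∀ y, HasFDerivAt (fun y : EuclideanSpace ℝ (Fin n) => ‖y - e‖ ^ 2)
      ((2 : ℝ) • innerSL ℝ (y - e)) y := fun y => by
    refine ((hasFDerivAt_id y).sub_const e).norm_sq.congr_fderiv ?_
    ext v
    simp [two_smul]
  have hcont : ContinuousAt (fun y : EuclideanSpace ℝ (Fin n) => ‖y - e‖ ^ 2) x :=
    (hq x).continuousAt
  have hfirst : fderiv ℝ (fun y => f (‖y - e‖ ^ 2)) =ᶠ[nhds x]
      fun y => deriv f (‖y - e‖ ^ 2) • ((2 : ℝ) • innerSL ℝ (y - e)) := by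
    filter_upwards [hcont.eventually hf] with y hy
    exact (hy.hasDerivAt.comp_hasFDerivAt y (hq y)).fderiv
  have hlin : HasFDerivAt (fun y : EuclideanSpace ℝ (Fin n) => (2 : ℝ) • innerSL ℝ (y - e))
      ((2 : ℝ) • innerSL ℝ) x :=
    (((innerSL ℝ).hasFDerivAt (x := x - e)).comp x ((hasFDerivAt_id x).sub_const e)).const_smul
      (2 : ℝ)
  have hsecond := (hdf.hasDerivAt.comp_hasFDerivAt x (hq x)).smul hlin
  have hterm : ∀ i : Fin n, iteratedFDeriv ℝ 2 (fun y => f (‖y - e‖ ^ 2)) x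
      ![EuclideanSpace.single i 1, EuclideanSpace.single i 1] =
      4 * deriv (deriv f) (‖x - e‖ ^ 2) * ((x - e) i) ^ 2 + 2 * deriv f (‖x - e‖ ^ 2) := by
    intro i
    rw [iteratedFDeriv_two_apply, hfirst.fderiv_eq]
    have hs := congrArg (fun A => A (EuclideanSpace.single i 1) (EuclideanSpace.single i 1))
      hsecond.fderiv
    refine hs.trans ?_
    change deriv f (‖x - e‖ ^ 2) * (2 * inner ℝ (EuclideanSpace.single i (1 : ℝ))
        (EuclideanSpace.single i (1 : ℝ))) +
      deriv (deriv f) (‖x - e‖ ^ 2) * (2 * inner ℝ (x - e) (EuclideanSpace.single i (1 : ℝ))) *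
        (2 * inner ℝ (x - e) (EuclideanSpace.single i (1 : ℝ))) = _
    simp [EuclideanSpace.inner_single_right]
    ring
  unfold eucLaplacian
  simp_rw [hterm]
  rw [Finset.sum_add_distrib, ← Finset.mul_sum, ← EuclideanSpace.real_norm_sq_eq]
  simp
  ring

/-- The partial derivative with respect to the second variable. -/
noncomputable def partialSnd (Φ : ℝ × ℝ → ℝ) : ℝ × ℝ → ℝ :=
  fun p => deriv (fun s => Φ (p.1, s)) p.2

/-- The operator `-Δ` in `ℝⁿ` acting on functions of a parameter and of `‖x‖²`. -/
noncomputable def radialNegLap (n : ℕ) (Φ : ℝ × ℝ → ℝ) : ℝ × ℝ → ℝ :=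
  fun p => -(4 * p.2 * partialSnd (partialSnd Φ) p + 2 * n * partialSnd Φ p)

theorem hasDerivAt_snd_of_contDiffOn {Φ : ℝ × ℝ → ℝ} {U : Set (ℝ × ℝ)} (hU : IsOpen U)
    (hΦ : ContDiffOn ℝ (⊤ : ℕ∞) Φ U) {p : ℝ × ℝ} (hp : p ∈ U) :
    HasDerivAt (fun s => Φ (p.1, s)) (fderiv ℝ Φ p (0, 1)) p.2 := by
  have h1 : HasFDerivAt Φ (fderiv ℝ Φ p) (p.1, p.2) :=
    ((hΦ.contDiffAt (hU.mem_nhds hp)).differentiableAt (by simp)).hasFDerivAt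
  exact h1.comp_hasDerivAt p.2 ((hasDerivAt_const p.2 p.1).prodMk (hasDerivAt_id p.2))

theorem ContDiffOn.partialSnd {Φ : ℝ × ℝ → ℝ} {U : Set (ℝ × ℝ)} (hU : IsOpen U)
    (hΦ : ContDiffOn ℝ (⊤ : ℕ∞) Φ U) : ContDiffOn ℝ (⊤ : ℕ∞) (partialSnd Φ) U :=
  ((hΦ.fderiv_of_isOpen hU (m := (⊤ : ℕ∞)) (by simp)).clm_apply contDiffOn_const).congr
    fun _ hp => (hasDerivAt_snd_of_contDiffOn hU hΦ hp).deriv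

theorem ContDiffOn.radialNegLap {n : ℕ} {Φ : ℝ × ℝ → ℝ} {U : Set (ℝ × ℝ)} (hU : IsOpen U)
    (hΦ : ContDiffOn ℝ (⊤ : ℕ∞) Φ U) : ContDiffOn ℝ (⊤ : ℕ∞) (radialNegLap n Φ) U := by
  have h1 := hΦ.partialSnd hU
  have h2 := h1.partialSnd hU
  unfold _root_.radialNegLap
  fun_prop

theorem ContDiffOn.radialNegLap_iterate {n : ℕ} {Φ : ℝ × ℝ → ℝ} {U : Set (ℝ × ℝ)}
    (hU : IsOpen U) (hΦ : ContDiffOn ℝ (⊤ : ℕ∞) Φ U) (j : ℕ) :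
    ContDiffOn ℝ (⊤ : ℕ∞) ((_root_.radialNegLap n)^[j] Φ) U := by
  induction j with
  | zero => exact hΦ
  | succ j ih => rw [Function.iterate_succ_apply']; exact ih.radialNegLap hU

theorem Set.EqOn.partialSnd {Φ Ψ : ℝ × ℝ → ℝ} {U : Set (ℝ × ℝ)} (hU : IsOpen U)
    (h : Set.EqOn Φ Ψ U) : Set.EqOn (partialSnd Φ) (partialSnd Ψ) U := fun p hp => by
  refine Filter.EventuallyEq.deriv_eq ?_
  have hc : ContinuousAt (fun s : ℝ => (p.1, s)) p.2 := by fun_prop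
  filter_upwards [hc.eventually (hU.mem_nhds hp)] with s hs using h hs

theorem Set.EqOn.radialNegLap {n : ℕ} {Φ Ψ : ℝ × ℝ → ℝ} {U : Set (ℝ × ℝ)} (hU : IsOpen U)
    (h : Set.EqOn Φ Ψ U) : Set.EqOn (radialNegLap n Φ) (radialNegLap n Ψ) U := fun p hp => by
  simp only [_root_.radialNegLap, h.partialSnd hU hp, (h.partialSnd hU).partialSnd hU hp]

theorem Set.EqOn.radialNegLap_iterate {n : ℕ} {Φ Ψ : ℝ × ℝ → ℝ} {U : Set (ℝ × ℝ)}
    (hU : IsOpen U) (h : Set.EqOn Φ Ψ U) (j : ℕ) :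
    Set.EqOn ((_root_.radialNegLap n)^[j] Φ) ((_root_.radialNegLap n)^[j] Ψ) U := by
  induction j with
  | zero => exact h
  | succ j ih => simp only [Function.iterate_succ_apply']; exact ih.radialNegLap hU

/-- The region on which `t + r` is positive. -/
def posSum : Set (ℝ × ℝ) := {p | 0 < p.1 + p.2}

theorem isOpen_posSum : IsOpen posSum :=
  isOpen_lt continuous_const (continuous_fst.add continuous_snd)

theorem negLapPow_radial {n : ℕ} {Φ : ℝ × ℝ → ℝ} (hΦ : ContDiffOn ℝ (⊤ : ℕ∞) Φ posSum)
    (e : EuclideanSpace ℝ (Fin n)) {t : ℝ} (ht : 0 < t) (j : ℕ) :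
    negLapPow j (fun x => Φ (t, ‖x - e‖ ^ 2)) =
      fun x => (radialNegLap n)^[j] Φ (t, ‖x - e‖ ^ 2) := by
  induction j with
  | zero => rfl
  | succ j ih =>
    have hpos : ∀ x : EuclideanSpace ℝ (Fin n), (t, ‖x - e‖ ^ 2) ∈ posSum := fun x => by
      simp only [posSum, Set.mem_ofPred_eq]; positivity
    have hj := hΦ.radialNegLap_iterate (n := n) isOpen_posSum j
    unfold negLapPow at ih ⊢
    simp only [Function.iterate_succ_apply']
    rw [ih]
    funext x
    rw [eucLaplacian_radial (f := fun s => (radialNegLap n)^[j] Φ (t, s))]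
    · rfl
    · have hc : ContinuousAt (fun s : ℝ => (t, s)) (‖x - e‖ ^ 2) := by fun_prop
      filter_upwards [hc.eventually (isOpen_posSum.mem_nhds (hpos x))] with s hs
      have hs' : (t, s) ∈ posSum := hs
      exact (hasDerivAt_snd_of_contDiffOn isOpen_posSum hj hs').differentiableAt
    · exact (hasDerivAt_snd_of_contDiffOn isOpen_posSum (hj.partialSnd isOpen_posSum)
        (hpos x)).differentiableAt

theorem hasDerivAt_add_rpow_neg (a : ℝ) {p : ℝ × ℝ} (hp : p ∈ posSum) :
    HasDerivAt (fun s => (p.1 + s) ^ (-a)) (-a * (p.1 + p.2) ^ (-(a + 1))) p.2 := by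
  have h := ((hasDerivAt_id p.2).const_add p.1).rpow_const (p := -a) (Or.inl (ne_of_gt hp))
  refine h.congr_deriv ?_
  rw [show -(a + 1) = -a - 1 by ring]
  simp

/-- The action of the radial operator on a power of `t + r`. -/
theorem radialNegLap_add_rpow_neg (n : ℕ) (c : ℝ → ℝ) (a : ℝ) :
    Set.EqOn (radialNegLap n fun p => c p.1 * (p.1 + p.2) ^ (-a))
      (fun p => 4 * c p.1 * a * (n / 2 - a - 1) * (p.1 + p.2) ^ (-(a + 1)) +
        4 * c p.1 * p.1 * a * (a + 1) * (p.1 + p.2) ^ (-(a + 2))) posSum := by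
  have h1 : ∀ (c : ℝ → ℝ) (a : ℝ), Set.EqOn (partialSnd fun p => c p.1 * (p.1 + p.2) ^ (-a))
      (fun p => (c p.1 * -a) * (p.1 + p.2) ^ (-(a + 1))) posSum := fun c a p hp => by
    refine (((hasDerivAt_add_rpow_neg a hp).const_mul (c p.1)).deriv).trans ?_
    ring
  intro p hp
  simp only [radialNegLap]
  rw [(h1 c a).partialSnd isOpen_posSum hp, h1 c a hp, h1 (fun t => c t * -a) (a + 1) hp]
  have hp0 : 0 < p.1 + p.2 := hp
  have h2 : (p.1 + p.2) ^ (-(a + 1)) = (p.1 + p.2) * (p.1 + p.2) ^ (-(a + 2)) := by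
    rw [show -(a + 1) = 1 + -(a + 2) by ring, Real.rpow_add hp0, Real.rpow_one]
  simp only [show a + 1 + 1 = a + 2 by ring, h2]
  ring

theorem partialSnd_linear {Φ Ψ : ℝ × ℝ → ℝ} {U : Set (ℝ × ℝ)} (hU : IsOpen U)
    (hΦ : ContDiffOn ℝ (⊤ : ℕ∞) Φ U) (hΨ : ContDiffOn ℝ (⊤ : ℕ∞) Ψ U) (b c : ℝ → ℝ) :
    Set.EqOn (partialSnd fun p => b p.1 * Φ p + c p.1 * Ψ p)
      (fun p => b p.1 * partialSnd Φ p + c p.1 * partialSnd Ψ p) U := fun p hp => by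
  have h1 := (hasDerivAt_snd_of_contDiffOn hU hΦ hp).differentiableAt.hasDerivAt
  have h2 := (hasDerivAt_snd_of_contDiffOn hU hΨ hp).differentiableAt.hasDerivAt
  exact ((h1.const_mul (b p.1)).add (h2.const_mul (c p.1))).deriv

theorem radialNegLap_linear {n : ℕ} {Φ Ψ : ℝ × ℝ → ℝ} {U : Set (ℝ × ℝ)} (hU : IsOpen U)
    (hΦ : ContDiffOn ℝ (⊤ : ℕ∞) Φ U) (hΨ : ContDiffOn ℝ (⊤ : ℕ∞) Ψ U) (b c : ℝ → ℝ) :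
    Set.EqOn (radialNegLap n fun p => b p.1 * Φ p + c p.1 * Ψ p)
      (fun p => b p.1 * radialNegLap n Φ p + c p.1 * radialNegLap n Ψ p) U := fun p hp => by
  have h1 := partialSnd_linear hU hΦ hΨ b c
  have h2 := partialSnd_linear hU (hΦ.partialSnd hU) (hΨ.partialSnd hU) b c
  simp only [radialNegLap, h1 hp, h1.partialSnd hU hp, h2 hp]
  ring

theorem radialNegLap_iterate_linear {n : ℕ} {Φ Ψ : ℝ × ℝ → ℝ} {U : Set (ℝ × ℝ)} (hU : IsOpen U)
    (hΦ : ContDiffOn ℝ (⊤ : ℕ∞) Φ U) (hΨ : ContDiffOn ℝ (⊤ : ℕ∞) Ψ U) (b c : ℝ → ℝ) (j : ℕ) :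
    Set.EqOn ((radialNegLap n)^[j] fun p => b p.1 * Φ p + c p.1 * Ψ p)
      (fun p => b p.1 * (radialNegLap n)^[j] Φ p + c p.1 * (radialNegLap n)^[j] Ψ p) U := by
  induction j with
  | zero => exact fun _ _ => rfl
  | succ j ih =>
    simp only [Function.iterate_succ_apply']
    exact (ih.radialNegLap hU).trans (radialNegLap_linear hU (hΦ.radialNegLap_iterate hU j)
      (hΨ.radialNegLap_iterate hU j) b c)

theorem contDiffOn_add_rpow (a : ℝ) :
    ContDiffOn ℝ (⊤ : ℕ∞) (fun p : ℝ × ℝ => (p.1 + p.2) ^ a) posSum :=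
  (contDiffOn_fst.add contDiffOn_snd).rpow_const_of_ne fun _ hp => ne_of_gt hp

/-- The product `∏_{i < k} (n/2 - i - 1) (n/2 + i)`, which equals `Γ(n/2 + k) / Γ(n/2 - k)`. -/
noncomputable def bubbleCoeff (n k : ℕ) : ℝ :=
  ∏ i ∈ Finset.range k, (((n : ℝ) / 2 - i - 1) * (n / 2 + i))

theorem bubbleCoeff_succ (n k : ℕ) :
    bubbleCoeff n (k + 1) = bubbleCoeff n k * (((n : ℝ) / 2 - k - 1) * (n / 2 + k)) :=
  Finset.prod_range_succ _ _

/-- The bubble `(t + r)^{-(n/2 - k)}` is mapped by `(-Δ)^k` to a multiple of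
`(t + r)^{-(n/2 + k)}`. -/
theorem radialNegLap_iterate_bubble (n k : ℕ) :
    Set.EqOn ((radialNegLap n)^[k] fun p => (p.1 + p.2) ^ (-((n : ℝ) / 2 - k)))
      (fun p => 4 ^ k * bubbleCoeff n k * p.1 ^ k * (p.1 + p.2) ^ (-((n : ℝ) / 2 + k)))
      posSum := by
  induction k using Nat.twoStepInduction with
  | zero => intro p _; simp [bubbleCoeff]
  | one =>
    intro p hp
    have h := radialNegLap_add_rpow_neg n (fun _ => 1) ((n : ℝ) / 2 - 1) hp
    simp only [one_mul] at h
    simp only [Function.iterate_one, Nat.cast_one]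
    rw [h, show (n : ℝ) / 2 - 1 + 2 = n / 2 + 1 by ring]
    simp only [bubbleCoeff, Finset.prod_range_one, Nat.cast_zero, pow_one]
    ring
  | more j ih₀ ih₁ =>
    intro p hp
    have hstep := radialNegLap_add_rpow_neg n (fun _ => 1) ((n : ℝ) / 2 - (j + 2))
    simp only [one_mul] at hstep
    have hsum : Set.EqOn (radialNegLap n fun p => (p.1 + p.2) ^ (-((n : ℝ) / 2 - (j + 2))))
        (fun p => (fun _ : ℝ => 4 * ((n : ℝ) / 2 - (j + 2)) * (j + 1)) p.1 *
            (p.1 + p.2) ^ (-((n : ℝ) / 2 - ((j + 1 : ℕ) : ℝ))) +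
          (fun t : ℝ => 4 * t * ((n : ℝ) / 2 - (j + 2)) * ((n : ℝ) / 2 - (j + 1))) p.1 *
            (p.1 + p.2) ^ (-((n : ℝ) / 2 - j))) posSum := fun q hq => by
      rw [hstep hq]
      push_cast
      rw [show (n : ℝ) / 2 - (j + 2) + 1 = n / 2 - (j + 1) by ring,
        show (n : ℝ) / 2 - (j + 2) + 2 = n / 2 - j by ring]
      ring
    have hlast := (ih₀.radialNegLap (n := n) isOpen_posSum).trans (radialNegLap_add_rpow_neg n
      (fun t => 4 ^ j * bubbleCoeff n j * t ^ j) ((n : ℝ) / 2 + j))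
    simp only [Nat.cast_add, Nat.cast_ofNat]
    rw [Function.iterate_succ_apply, hsum.radialNegLap_iterate isOpen_posSum (j + 1) hp]
    refine (radialNegLap_iterate_linear isOpen_posSum (contDiffOn_add_rpow _)
      (contDiffOn_add_rpow _) (fun _ => 4 * ((n : ℝ) / 2 - (j + 2)) * (j + 1))
      (fun t => 4 * t * ((n : ℝ) / 2 - (j + 2)) * ((n : ℝ) / 2 - (j + 1))) (j + 1) hp).trans ?_
    simp only
    rw [ih₁ hp, Function.iterate_succ_apply', hlast hp, bubbleCoeff_succ n (j + 1),
      bubbleCoeff_succ n j]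
    push_cast
    rw [show (n : ℝ) / 2 + j + 1 = n / 2 + (j + 1) by ring,
      show (n : ℝ) / 2 + j + 2 = n / 2 + (j + 2) by ring]
    ring

theorem bubbleCoeff_eq_Gamma_div {n k : ℕ} (h : 2 * k < n) :
    bubbleCoeff n k = Real.Gamma (((n : ℝ) + 2 * k) / 2) / Real.Gamma (((n : ℝ) - 2 * k) / 2) := by
  induction k with
  | zero =>
    have hn : (0 : ℝ) < n := by exact_mod_cast (by omega : 0 < n)
    simp [bubbleCoeff, (Real.Gamma_pos_of_pos (half_pos hn)).ne']
  | succ k ih =>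
    have hn : 2 * ((k : ℝ) + 1) < n := by exact_mod_cast h
    have hk : (0 : ℝ) ≤ k := k.cast_nonneg
    rw [bubbleCoeff_succ, ih (by omega)]
    push_cast
    rw [show ((n : ℝ) + 2 * (k + 1)) / 2 = (n + 2 * k) / 2 + 1 by ring,
      show ((n : ℝ) - 2 * k) / 2 = (n - 2 * (k + 1)) / 2 + 1 by ring,
      Real.Gamma_add_one (by linarith), Real.Gamma_add_one (by linarith)]
    have h1 : 0 < ((n : ℝ) - 2 * (k + 1)) / 2 := by linarith
    rw [show (n : ℝ) / 2 - k - 1 = (n - 2 * (k + 1)) / 2 by ring,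
      show (n : ℝ) / 2 + k = (n + 2 * k) / 2 by ring]
    generalize ((n : ℝ) - 2 * (k + 1)) / 2 = a at h1 ⊢
    have h2 := (Real.Gamma_pos_of_pos h1).ne'
    field_simp


theorem integrable_one_add_norm_sq_rpow_neg {n : ℕ} (hn : 0 < n) :
    Integrable fun x : EuclideanSpace ℝ (Fin n) => (1 + ‖x‖ ^ 2) ^ (-(n : ℝ)) := by
  have hn' : (0 : ℝ) < n := by exact_mod_cast hn
  have h := integrable_rpow_neg_one_add_norm_sq (E := EuclideanSpace ℝ (Fin n)) (μ := volume)
    (r := 2 * n) (by simp only [finrank_euclideanSpace_fin]; linarith)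
  simpa only [show -(2 * (n : ℝ)) / 2 = -n by ring] using h

/-- The volume of the `n`-sphere in stereographic coordinates, up to the factor `2 ^ n`. -/
theorem integral_one_add_norm_sq_rpow_neg {n : ℕ} (hn : 0 < n) :
    ∫ x : EuclideanSpace ℝ (Fin n), (1 + ‖x‖ ^ 2) ^ (-(n : ℝ)) =
      2 * π ^ (((n : ℝ) + 1) / 2) / Real.Gamma (((n : ℝ) + 1) / 2) / 2 ^ (n : ℝ) := by
  have hn' : (0 : ℝ) < n := by exact_mod_cast hn
  have hone : ∀ x : EuclideanSpace ℝ (Fin n), 0 < 1 + ‖x‖ ^ 2 := fun x => by positivity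
  have hG := Real.Gamma_pos_of_pos hn'
  set F : EuclideanSpace ℝ (Fin n) → ℝ → ℝ :=
    fun x s => s ^ ((n : ℝ) - 1) * exp (-((1 + ‖x‖ ^ 2) * s)) with hF
  have hinner : ∀ x, ∫ s in Set.Ioi 0, F x s = (1 + ‖x‖ ^ 2) ^ (-(n : ℝ)) * Real.Gamma n :=
    fun x => by
      rw [Real.integral_rpow_mul_exp_neg_mul_Ioi hn' (hone x), one_div,
        Real.inv_rpow (hone x).le, Real.rpow_neg (hone x).le]
  have hint : Integrable (Function.uncurry F)
      ((volume : Measure (EuclideanSpace ℝ (Fin n))).prod (volume.restrict (Set.Ioi 0))) := by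
    rw [integrable_prod_iff (by
      refine Measurable.aestronglyMeasurable ?_
      simp only [hF, Function.uncurry_def]
      fun_prop)]
    constructor
    · refine Filter.Eventually.of_forall fun x => ?_
      have h := integrableOn_rpow_mul_exp_neg_mul_rpow (p := 1) (s := (n : ℝ) - 1)
        (by linarith) one_pos (hone x)
      simpa only [hF, Function.uncurry_apply_pair, Real.rpow_one, neg_mul, IntegrableOn] using h
    · have hnorm : ∀ x, ∫ s in Set.Ioi 0, ‖Function.uncurry F (x, s)‖ =
          (1 + ‖x‖ ^ 2) ^ (-(n : ℝ)) * Real.Gamma n := fun x => by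
        rw [← hinner x]
        refine setIntegral_congr_fun measurableSet_Ioi fun s hs => ?_
        exact Real.norm_of_nonneg (mul_nonneg (Real.rpow_nonneg (le_of_lt hs) _) (exp_pos _).le)
      simp_rw [hnorm]
      exact (integrable_one_add_norm_sq_rpow_neg hn).mul_const _
  have hswap := integral_integral_swap hint
  simp_rw [hinner, integral_mul_const] at hswap
  have hgauss : ∀ s ∈ Set.Ioi (0 : ℝ), ∫ x, F x s =
      π ^ ((n : ℝ) / 2) * (s ^ ((n : ℝ) / 2 - 1) * exp (-(1 * s))) := fun s hs => by
    have hs0 : 0 < s := hs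
    have h : ∀ x, F x s = s ^ ((n : ℝ) - 1) * exp (-(1 * s)) * exp (-s * ‖x‖ ^ 2) := fun x => by
      simp only [hF]
      rw [mul_assoc, ← Real.exp_add]
      ring_nf
    simp_rw [h]
    rw [integral_const_mul, GaussianFourier.integral_rexp_neg_mul_sq_norm hs0,
      finrank_euclideanSpace_fin, Real.div_rpow pi_pos.le hs0.le,
      show (n : ℝ) / 2 - 1 = (n - 1) - n / 2 by ring, Real.rpow_sub hs0 _ ((n : ℝ) / 2)]
    ring
  rw [setIntegral_congr_fun measurableSet_Ioi hgauss, integral_const_mul,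
    Real.integral_rpow_mul_exp_neg_mul_Ioi (half_pos hn') one_pos] at hswap
  have hdup := Real.Gamma_mul_Gamma_add_half ((n : ℝ) / 2)
  rw [show (n : ℝ) / 2 + 1 / 2 = (n + 1) / 2 by ring, show 2 * ((n : ℝ) / 2) = n by ring,
    Real.rpow_sub two_pos, Real.rpow_one, Real.sqrt_eq_rpow] at hdup
  have hG2 := Real.Gamma_pos_of_pos (show 0 < ((n : ℝ) + 1) / 2 by linarith)
  have h2n : (0 : ℝ) < 2 ^ (n : ℝ) := by positivity
  rw [show ((n : ℝ) + 1) / 2 = n / 2 + 1 / 2 by ring, Real.rpow_add pi_pos]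
  rw [show ((n : ℝ) + 1) / 2 = n / 2 + 1 / 2 by ring] at hdup hG2
  simp only [div_one, Real.one_rpow, one_mul] at hswap
  generalize (∫ x : EuclideanSpace ℝ (Fin n), (1 + ‖x‖ ^ 2) ^ (-(n : ℝ))) = I at hswap ⊢
  generalize Real.Gamma ((n : ℝ) / 2 + 1 / 2) = G2 at *
  have hI : I = π ^ ((n : ℝ) / 2) * Real.Gamma ((n : ℝ) / 2) / Real.Gamma n := by
    rw [eq_div_iff hG.ne', hswap]
  have hG1 : Real.Gamma ((n : ℝ) / 2) =
      Real.Gamma n * (2 / 2 ^ (n : ℝ)) * π ^ (1 / 2 : ℝ) / G2 := by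
    rw [eq_div_iff hG2.ne', hdup]
  rw [hI, hG1]
  field_simp

theorem add_norm_sq_rpow_neg_eq {n : ℕ} {t : ℝ} (ht : 0 < t) (x : EuclideanSpace ℝ (Fin n)) :
    (t + ‖x‖ ^ 2) ^ (-(n : ℝ)) = t ^ (-(n : ℝ)) * (1 + ‖(√t)⁻¹ • x‖ ^ 2) ^ (-(n : ℝ)) := by
  rw [← Real.mul_rpow ht.le (by positivity), norm_smul, norm_inv,
    Real.norm_of_nonneg (by positivity),
    mul_pow, inv_pow, Real.sq_sqrt ht.le, mul_add, mul_one, ← mul_assoc, mul_inv_cancel₀ ht.ne',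
    one_mul]

theorem integrable_add_norm_sq_rpow_neg {n : ℕ} (hn : 0 < n) {t : ℝ} (ht : 0 < t) :
    Integrable fun x : EuclideanSpace ℝ (Fin n) => (t + ‖x‖ ^ 2) ^ (-(n : ℝ)) := by
  simp_rw [add_norm_sq_rpow_neg_eq ht]
  exact ((integrable_one_add_norm_sq_rpow_neg hn).comp_smul
    (inv_ne_zero (Real.sqrt_pos.2 ht).ne')).const_mul _

theorem integral_add_norm_sq_rpow_neg {n : ℕ} {t : ℝ} (ht : 0 < t) :
    ∫ x : EuclideanSpace ℝ (Fin n), (t + ‖x‖ ^ 2) ^ (-(n : ℝ)) =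
      t ^ (-((n : ℝ) / 2)) * ∫ x : EuclideanSpace ℝ (Fin n), (1 + ‖x‖ ^ 2) ^ (-(n : ℝ)) := by
  simp_rw [add_norm_sq_rpow_neg_eq ht]
  rw [integral_const_mul, Measure.integral_comp_smul volume
    (fun x : EuclideanSpace ℝ (Fin n) => (1 + ‖x‖ ^ 2) ^ (-(n : ℝ))), finrank_euclideanSpace_fin,
    smul_eq_mul, ← mul_assoc, inv_pow, inv_inv, abs_of_nonneg (by positivity),
    Real.sqrt_eq_rpow, ← Real.rpow_natCast, ← Real.rpow_mul ht.le, ← Real.rpow_add ht]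
  ring_nf

/-- The integrals of `(t + ‖x‖²)^{-a}` over a fixed ball blow up as `t → 0` when `n ≤ 2a`. -/
theorem exists_lt_setIntegral_add_norm_sq_rpow_neg {n : ℕ} (hn : 0 < n) {a ρ : ℝ}
    (ha : (n : ℝ) ≤ 2 * a) (hρ : 0 < ρ) (M : ℝ) :
    ∃ t : ℝ, 0 < t ∧ t ≤ 1 ∧
      M < ∫ x in Metric.ball (0 : EuclideanSpace ℝ (Fin n)) ρ, (t + ‖x‖ ^ 2) ^ (-a) := by
  by_contra! hM
  have : Nonempty (Fin n) := ⟨⟨0, hn⟩⟩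
  have htpos : ∀ j : ℕ, (0 : ℝ) < 1 / ((j : ℝ) + 1) := fun j => by positivity
  have hbase : ∀ (j : ℕ) (x : EuclideanSpace ℝ (Fin n)), 0 < 1 / ((j : ℝ) + 1) + ‖x‖ ^ 2 :=
    fun j x => by have := htpos j; positivity
  set G : ℕ → EuclideanSpace ℝ (Fin n) → ENNReal :=
    fun j x => ENNReal.ofReal ((1 / ((j : ℝ) + 1) + ‖x‖ ^ 2) ^ (-a)) with hG
  have hcont : ∀ j : ℕ, Continuous fun x : EuclideanSpace ℝ (Fin n) =>
      (1 / ((j : ℝ) + 1) + ‖x‖ ^ 2) ^ (-a) := fun j =>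
    (by fun_prop : Continuous fun x : EuclideanSpace ℝ (Fin n) =>
      1 / ((j : ℝ) + 1) + ‖x‖ ^ 2).rpow_const fun x => Or.inl (hbase j x).ne'
  have hbound : ∀ j, ∫⁻ x in Metric.ball 0 ρ, G j x ≤ ENNReal.ofReal M := fun j => by
    rw [← ofReal_integral_eq_lintegral_ofReal]
    · refine ENNReal.ofReal_le_ofReal (hM _ (htpos j) ?_)
      rw [div_le_one (by positivity)]
      linarith [(j.cast_nonneg : (0 : ℝ) ≤ j)]
    · exact ((hcont j).continuousOn.integrableOn_compact
        (isCompact_closedBall (0 : EuclideanSpace ℝ (Fin n)) ρ)).mono_set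
          Metric.ball_subset_closedBall
    · exact Filter.Eventually.of_forall fun x => Real.rpow_nonneg (hbase j x).le _
  have hfatou : ∫⁻ x in Metric.ball (0 : EuclideanSpace ℝ (Fin n)) ρ,
      ENNReal.ofReal ((‖x‖ ^ 2) ^ (-a)) ≤ ENNReal.ofReal M := by
    calc _ = ∫⁻ x in Metric.ball (0 : EuclideanSpace ℝ (Fin n)) ρ,
          Filter.liminf (fun j => G j x) Filter.atTop := by
          refine lintegral_congr_ae ?_
          filter_upwards [ae_restrict_of_ae (Measure.ae_ne volume (0 : EuclideanSpace ℝ (Fin n)))]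
            with x hx
          refine (Filter.Tendsto.liminf_eq ?_).symm
          refine ENNReal.tendsto_ofReal ?_
          have h0 : Filter.Tendsto (fun j : ℕ => 1 / ((j : ℝ) + 1) + ‖x‖ ^ 2) Filter.atTop
              (nhds (‖x‖ ^ 2)) := by
            simpa using (tendsto_one_div_add_atTop_nhds_zero_nat (𝕜 := ℝ)).add_const (‖x‖ ^ 2)
          exact h0.rpow_const (Or.inl (by simpa using hx))
      _ ≤ Filter.liminf (fun j => ∫⁻ x in Metric.ball 0 ρ, G j x) Filter.atTop :=
          lintegral_liminf_le fun j => (hcont j).measurable.ennreal_ofReal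
      _ ≤ Filter.liminf (fun _ : ℕ => ENNReal.ofReal M) Filter.atTop :=
          Filter.liminf_le_liminf (Filter.Eventually.of_forall hbound)
      _ = ENNReal.ofReal M := Filter.liminf_const _
  have hint : IntegrableOn (fun x : EuclideanSpace ℝ (Fin n) => (‖x‖ ^ 2) ^ (-a))
      (Metric.ball 0 ρ) := by
    refine ⟨(by fun_prop : Measurable _).aestronglyMeasurable, ?_⟩
    rw [hasFiniteIntegral_iff_ofReal
      (Filter.Eventually.of_forall fun x => Real.rpow_nonneg (by positivity) _)]
    exact hfatou.trans_lt ENNReal.ofReal_lt_top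
  rw [integrableOn_fun_norm_addHaar (E := EuclideanSpace ℝ (Fin n)) volume
    (f := fun r => (r ^ 2) ^ (-a)), finrank_euclideanSpace_fin] at hint
  have hpow : IntegrableOn (fun y : ℝ => y ^ ((n : ℝ) - 1 - 2 * a)) (Set.Ioo 0 ρ) := by
    refine hint.congr_fun (fun y hy => ?_) measurableSet_Ioo
    have hy0 : 0 < y := hy.1
    simp only [smul_eq_mul]
    rw [← Real.rpow_natCast, ← Real.rpow_natCast, ← Real.rpow_mul hy0.le, ← Real.rpow_add hy0,
      Nat.cast_sub hn]
    push_cast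
    ring_nf
  rw [intervalIntegral.integrableOn_Ioo_rpow_iff hρ] at hpow
  linarith

theorem ContDiffOn.comp_norm_sub_sq {n : ℕ} {Φ : ℝ × ℝ → ℝ}
    (hΦ : ContDiffOn ℝ (⊤ : ℕ∞) Φ posSum) (e : EuclideanSpace ℝ (Fin n)) {t : ℝ} (ht : 0 < t) :
    ContDiff ℝ (⊤ : ℕ∞) fun x => Φ (t, ‖x - e‖ ^ 2) :=
  hΦ.comp_contDiff (contDiff_const.prodMk ((contDiff_id.sub contDiff_const).norm_sq ℝ)) fun x => by
    simp only [posSum, Set.mem_ofPred_eq]; positivity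

/-- The bubble `(t + r)^{-m}`, cut off smoothly where `1/8 ≤ r ≤ 1/4`. -/
noncomputable def cutoffBubble (m : ℝ) : ℝ × ℝ → ℝ :=
  fun p => smoothTransition (2 - 8 * p.2) * (p.1 + p.2) ^ (-m)

theorem contDiffOn_cutoffBubble (m : ℝ) : ContDiffOn ℝ (⊤ : ℕ∞) (cutoffBubble m) posSum := by
  refine ContDiffOn.mul (ContDiff.contDiffOn ?_) (contDiffOn_add_rpow (-m))
  exact smoothTransition.contDiff.comp (by fun_prop)

theorem cutoffBubble_eq_zero (m t : ℝ) {r : ℝ} (hr : 1 / 4 ≤ r) : cutoffBubble m (t, r) = 0 := by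
  simp [cutoffBubble, smoothTransition.zero_of_nonpos (show 2 - 8 * r ≤ 0 by linarith)]

theorem cutoffBubble_eq (m t : ℝ) {r : ℝ} (hr : r ≤ 1 / 8) :
    cutoffBubble m (t, r) = (t + r) ^ (-m) := by
  simp [cutoffBubble, smoothTransition.one_of_one_le (show 1 ≤ 2 - 8 * r by linarith)]

theorem bubbleCoeff_nonneg {n k : ℕ} (h : 2 * k < n) : 0 ≤ bubbleCoeff n k := by
  have h' : 2 * (k : ℝ) < n := by exact_mod_cast h
  have hk : (0 : ℝ) ≤ k := k.cast_nonneg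
  rw [bubbleCoeff_eq_Gamma_div h]
  exact div_nonneg (Real.Gamma_pos_of_pos (by linarith)).le
    (Real.Gamma_pos_of_pos (by linarith)).le

/-- Pointwise control of the energy density of the cut off bubble, uniformly in `t`. -/
theorem exists_cutoffBubble_mul_le {n k : ℕ} (h : 2 * k < n) :
    ∃ C : ℝ, 0 ≤ C ∧ ∀ t r : ℝ, 0 < t → t ≤ 1 → 0 ≤ r →
      cutoffBubble ((n : ℝ) / 2 - k) (t, r) *
          (radialNegLap n)^[k] (cutoffBubble ((n : ℝ) / 2 - k)) (t, r) ≤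
        4 ^ k * bubbleCoeff n k * t ^ k * (t + r) ^ (-(n : ℝ)) +
          (Set.Iic (1 / 4)).indicator (fun _ => C) r := by
  set m : ℝ := (n : ℝ) / 2 - k with hm
  have hsmooth := contDiffOn_cutoffBubble m
  have hcont : ContinuousOn
      (fun p => cutoffBubble m p * (radialNegLap n)^[k] (cutoffBubble m) p) posSum :=
    hsmooth.continuousOn.mul (hsmooth.radialNegLap_iterate isOpen_posSum k).continuousOn
  have hsub : Set.Icc (0 : ℝ) 1 ×ˢ Set.Icc (1 / 8 : ℝ) (1 / 4) ⊆ posSum := by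
    rintro ⟨t, r⟩ ⟨ht, hr⟩
    change 0 < t + r
    linarith [ht.1, hr.1]
  obtain ⟨C, hC⟩ := (isCompact_Icc.prod isCompact_Icc).exists_bound_of_continuousOn
    (hcont.mono hsub)
  refine ⟨max C 0, le_max_right _ _, fun t r ht ht1 hr => ?_⟩
  have hcoef := bubbleCoeff_nonneg h
  have hmain : 0 ≤ 4 ^ k * bubbleCoeff n k * t ^ k * (t + r) ^ (-(n : ℝ)) := by positivity
  have hind : 0 ≤ (Set.Iic (1 / 4 : ℝ)).indicator (fun _ => max C 0) r :=
    Set.indicator_nonneg (fun _ _ => le_max_right _ _) r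
  rcases lt_or_ge r (1 / 8) with h8 | h8
  · set U : Set (ℝ × ℝ) := posSum ∩ {p | p.2 < 1 / 8} with hUdef
    have hU : IsOpen U := isOpen_posSum.inter (isOpen_lt continuous_snd continuous_const)
    have hmem : (t, r) ∈ U := ⟨(by positivity : 0 < t + r), h8⟩
    have heq : Set.EqOn (cutoffBubble m) (fun p => (p.1 + p.2) ^ (-m)) U := fun p hp =>
      cutoffBubble_eq m p.1 (le_of_lt hp.2)
    rw [heq.radialNegLap_iterate hU k hmem, radialNegLap_iterate_bubble n k hmem.1, heq hmem]
    refine le_of_eq_of_le ?_ (le_add_of_nonneg_right hind)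
    simp only
    rw [show -(n : ℝ) = -m + -((n : ℝ) / 2 + k) by rw [hm]; ring,
      Real.rpow_add (by positivity : 0 < t + r)]
    ring
  · rcases le_or_gt r (1 / 4) with h4 | h4
    · rw [Set.indicator_of_mem (by exact h4)]
      have hb := hC (t, r) ⟨⟨ht.le, ht1⟩, ⟨h8, h4⟩⟩
      linarith [le_abs_self (cutoffBubble m (t, r) * (radialNegLap n)^[k] (cutoffBubble m) (t, r)),
        le_max_left C 0, Real.norm_eq_abs
          (cutoffBubble m (t, r) * (radialNegLap n)^[k] (cutoffBubble m) (t, r))]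
    · rw [cutoffBubble_eq_zero m t h4.le, zero_mul]
      exact add_nonneg hmain hind

theorem cutoffBubble_hasCompactSupport {n : ℕ} (m t : ℝ) (e : EuclideanSpace ℝ (Fin n)) :
    HasCompactSupport fun x => cutoffBubble m (t, ‖x - e‖ ^ 2) := by
  refine HasCompactSupport.intro (isCompact_closedBall e (1 / 2)) fun x hx => ?_
  rw [Metric.mem_closedBall, dist_eq_norm, not_le] at hx
  exact cutoffBubble_eq_zero m t (by nlinarith)

/-- The energy of the cut off bubble exceeds that of the bubble by a bounded amount. -/
theorem exists_integral_cutoffBubble_mul_le {n k : ℕ} (h : 2 * k < n)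
    (e : EuclideanSpace ℝ (Fin n)) :
    ∃ C : ℝ, 0 ≤ C ∧ ∀ t : ℝ, 0 < t → t ≤ 1 →
      ∫ x : EuclideanSpace ℝ (Fin n), cutoffBubble ((n : ℝ) / 2 - k) (t, ‖x - e‖ ^ 2) *
          negLapPow k (fun y => cutoffBubble ((n : ℝ) / 2 - k) (t, ‖y - e‖ ^ 2)) x ≤
        4 ^ k * bubbleCoeff n k * t ^ k *
          (∫ x : EuclideanSpace ℝ (Fin n), (t + ‖x‖ ^ 2) ^ (-(n : ℝ))) + C := by
  obtain ⟨C, hC0, hC⟩ := exists_cutoffBubble_mul_le h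
  set B : EuclideanSpace ℝ (Fin n) → ℝ := (Metric.closedBall e (1 / 2)).indicator fun _ => C with hB
  have hBint : Integrable B :=
    (integrable_indicator_iff measurableSet_closedBall).2
      (integrableOn_const measure_closedBall_lt_top.ne)
  refine ⟨∫ x, B x, integral_nonneg (Set.indicator_nonneg fun _ _ => hC0), fun t ht ht1 => ?_⟩
  set m : ℝ := (n : ℝ) / 2 - k with hm
  have hsmooth := contDiffOn_cutoffBubble m
  rw [negLapPow_radial hsmooth e ht k]
  have hIint : Integrable fun x : EuclideanSpace ℝ (Fin n) =>
      4 ^ k * bubbleCoeff n k * t ^ k * (t + ‖x - e‖ ^ 2) ^ (-(n : ℝ)) :=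
    ((integrable_add_norm_sq_rpow_neg (by omega) ht).comp_sub_right e).const_mul _
  calc _ ≤ ∫ x : EuclideanSpace ℝ (Fin n),
        (4 ^ k * bubbleCoeff n k * t ^ k * (t + ‖x - e‖ ^ 2) ^ (-(n : ℝ)) + B x) := by
        refine integral_mono ?_ (hIint.add hBint) fun x => ?_
        · refine Continuous.integrable_of_hasCompactSupport ?_
            (cutoffBubble_hasCompactSupport m t e).mul_right
          exact (hsmooth.comp_norm_sub_sq e ht).continuous.mul
            ((hsmooth.radialNegLap_iterate isOpen_posSum k).comp_norm_sub_sq e ht).continuous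
        · refine (hC t (‖x - e‖ ^ 2) ht ht1 (by positivity)).trans_eq ?_
          congr 1
          refine Set.indicator_eq_indicator ?_ rfl
          rw [Set.mem_Iic, Metric.mem_closedBall, dist_eq_norm,
            show (1 / 4 : ℝ) = (1 / 2) ^ 2 by norm_num,
            pow_le_pow_iff_left₀ (norm_nonneg _) (by norm_num) two_ne_zero]
    _ = _ := by
        rw [integral_add hIint hBint, integral_const_mul,
          integral_sub_right_eq_self (fun x : EuclideanSpace ℝ (Fin n) =>
            (t + ‖x‖ ^ 2) ^ (-(n : ℝ))) e]

/-- The critical norm of the cut off bubble is that of the bubble up to a bounded amount. -/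
theorem le_integral_abs_cutoffBubble_rpow {n k : ℕ} (h : 2 * k < n)
    (e : EuclideanSpace ℝ (Fin n)) {t : ℝ} (ht : 0 < t) :
    (∫ x : EuclideanSpace ℝ (Fin n), (t + ‖x‖ ^ 2) ^ (-(n : ℝ))) -
        9 ^ (n : ℝ) * ∫ x : EuclideanSpace ℝ (Fin n), (1 + ‖x‖ ^ 2) ^ (-(n : ℝ)) ≤
      ∫ x : EuclideanSpace ℝ (Fin n), |cutoffBubble ((n : ℝ) / 2 - k) (t, ‖x - e‖ ^ 2)| ^
        (2 * (n : ℝ) / (n - 2 * k)) := by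
  have h' : 2 * (k : ℝ) < n := by exact_mod_cast h
  have hn0 : (0 : ℝ) < n := lt_of_le_of_lt (by positivity) h'
  have hp : 0 < 2 * (n : ℝ) / (n - 2 * k) := div_pos (by linarith) (by linarith)
  set m : ℝ := (n : ℝ) / 2 - k with hm
  have h1 := (integrable_add_norm_sq_rpow_neg (n := n) (by omega) ht).comp_sub_right e
  have h2 := ((integrable_one_add_norm_sq_rpow_neg (n := n) (by omega)).comp_sub_right e).const_mul
    (9 ^ (n : ℝ))
  rw [← integral_const_mul,
    ← integral_sub_right_eq_self (fun x : EuclideanSpace ℝ (Fin n) => (t + ‖x‖ ^ 2) ^ (-(n : ℝ))) e,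
    ← integral_sub_right_eq_self
      (fun x : EuclideanSpace ℝ (Fin n) => 9 ^ (n : ℝ) * (1 + ‖x‖ ^ 2) ^ (-(n : ℝ))) e,
    ← integral_sub h1 h2]
  refine integral_mono (h1.sub h2) ?_ fun x => ?_
  · refine Continuous.integrable_of_hasCompactSupport
      (((contDiffOn_cutoffBubble m).comp_norm_sub_sq e ht).continuous.abs.rpow_const
        fun x => Or.inr hp.le) ?_
    exact (cutoffBubble_hasCompactSupport m t e).comp_left (g := fun y => |y| ^ _)
      (by simp [Real.zero_rpow hp.ne'])
  · have hr : 0 ≤ ‖x - e‖ ^ 2 := by positivity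
    generalize ‖x - e‖ ^ 2 = r at hr
    rcases le_or_gt r (1 / 8) with h8 | h8
    · rw [cutoffBubble_eq m t h8, abs_of_nonneg (by positivity), ← Real.rpow_mul (by positivity),
        show -m * (2 * (n : ℝ) / (n - 2 * k)) = -n by
          rw [hm]; field_simp [show (n : ℝ) - 2 * k ≠ 0 by linarith]]
      exact sub_le_self _ (by positivity)
    · refine (sub_nonpos.2 ?_).trans (by positivity)
      rw [show (9 : ℝ) ^ (n : ℝ) = (1 / 9) ^ (-(n : ℝ)) by
        rw [Real.rpow_neg (by norm_num), ← Real.inv_rpow (by norm_num)]; norm_num,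
        ← Real.mul_rpow (by norm_num) (by positivity)]
      exact Real.rpow_le_rpow_of_nonpos (by positivity) (by linarith) (by linarith)

theorem sub_mul_rpow_le_rpow {I K N θ : ℝ} (hI : 0 < I) (hK : 0 ≤ K) (hN : I - K ≤ N)
    (hN0 : 0 ≤ N) (hθ0 : 0 ≤ θ) (hθ1 : θ ≤ 1) : (I - K) * I ^ (θ - 1) ≤ N ^ θ := by
  rcases le_or_gt I K with h | h
  · exact (mul_nonpos_of_nonpos_of_nonneg (by linarith) (by positivity)).trans (by positivity)
  · have hIK : 0 < I - K := by linarith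
    calc (I - K) * I ^ (θ - 1) = ((I - K) / I) ^ (1 : ℝ) * I ^ θ := by
          rw [Real.rpow_sub hI, Real.rpow_one, Real.rpow_one]; ring
      _ ≤ ((I - K) / I) ^ θ * I ^ θ := by
          refine mul_le_mul_of_nonneg_right ?_ (by positivity)
          exact Real.rpow_le_rpow_of_exponent_ge (by positivity)
            ((div_le_one hI).2 (by linarith)) hθ1
      _ = (I - K) ^ θ := by
          rw [← Real.mul_rpow (by positivity) hI.le, div_mul_cancel₀ _ hI.ne']
      _ ≤ N ^ θ := Real.rpow_le_rpow hIK.le hN hθ0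

/-- The value of the Sobolev quotient on bubbles is the sharp Sobolev constant. -/
theorem sobolevConst_mul_rpow {n k : ℕ} (hn : 0 < n) (P : ℝ) {t : ℝ} (ht : 0 < t) :
    P * (2 * π ^ (((n : ℝ) + 1) / 2) / Real.Gamma (((n : ℝ) + 1) / 2)) ^ (2 * (k : ℝ) / n) *
        (∫ x : EuclideanSpace ℝ (Fin n), (t + ‖x‖ ^ 2) ^ (-(n : ℝ))) ^
          (((n : ℝ) - 2 * k) / n - 1) = 4 ^ k * P * t ^ k := by
  have hn' : (0 : ℝ) < n := by exact_mod_cast hn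
  set ω : ℝ := 2 * π ^ (((n : ℝ) + 1) / 2) / Real.Gamma (((n : ℝ) + 1) / 2) with hω
  have hω0 : 0 < ω := by
    have := Real.Gamma_pos_of_pos (show 0 < ((n : ℝ) + 1) / 2 by linarith)
    positivity
  have hexp : ((n : ℝ) - 2 * k) / n - 1 = -(2 * k / n) := by field_simp; ring
  rw [integral_add_norm_sq_rpow_neg ht, integral_one_add_norm_sq_rpow_neg hn, ← hω, hexp,
    Real.mul_rpow (by positivity) (by positivity), Real.div_rpow hω0.le (by positivity),
    ← Real.rpow_mul ht.le, ← Real.rpow_mul two_pos.le, Real.rpow_neg hω0.le,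
    show -((n : ℝ) / 2) * -(2 * k / n) = k by field_simp,
    show (n : ℝ) * -(2 * k / n) = -(2 * k) by field_simp, Real.rpow_natCast,
    Real.rpow_neg two_pos.le, Real.rpow_mul two_pos.le, Real.rpow_natCast]
  have : 0 < ω ^ (2 * (k : ℝ) / n) := by positivity
  norm_num
  field_simp

theorem abs_apply_sub_one_le_norm {n : ℕ} (i : Fin n) (x : EuclideanSpace ℝ (Fin n)) :
    |x i - 1| ≤ ‖x - EuclideanSpace.single i 1‖ := by
  have h : ‖(x - EuclideanSpace.single i (1 : ℝ)) i‖ ≤ ‖x - EuclideanSpace.single i 1‖ :=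
    PiLp.norm_apply_le _ i
  simpa using h

theorem cutoffBubble_eq_zero_of_apply_lt {n : ℕ} (i : Fin n) (m t : ℝ)
    {x : EuclideanSpace ℝ (Fin n)} (hx : x i < 1 / 2) :
    cutoffBubble m (t, ‖x - EuclideanSpace.single i 1‖ ^ 2) = 0 := by
  have h := (neg_le_abs _).trans (abs_apply_sub_one_le_norm i x)
  exact cutoffBubble_eq_zero m t (by nlinarith)

/-- A lower bound for the Hardy term of the cut off bubble centred at a unit vector. -/
theorem le_setIntegral_cutoffBubble_sq_div {n : ℕ} (i : Fin n) (k : ℕ) (m : ℝ) {t : ℝ}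
    (ht : 0 < t) :
    (4 ^ k)⁻¹ * ∫ x in Metric.ball (0 : EuclideanSpace ℝ (Fin n)) (1 / 3),
        (t + ‖x‖ ^ 2) ^ (-(2 * m)) ≤
      ∫ x in {x : EuclideanSpace ℝ (Fin n) | 0 < x i},
        cutoffBubble m (t, ‖x - EuclideanSpace.single i 1‖ ^ 2) ^ 2 / x i ^ (2 * k) := by
  have hvanish := fun x : EuclideanSpace ℝ (Fin n) =>
    cutoffBubble_eq_zero_of_apply_lt (x := x) i m t
  have hcoord := abs_apply_sub_one_le_norm (n := n) i
  set e : EuclideanSpace ℝ (Fin n) := EuclideanSpace.single i 1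
  have hgc := ((contDiffOn_cutoffBubble m).comp_norm_sub_sq e ht).continuous
  rw [setIntegral_eq_integral_of_forall_compl_eq_zero
      (s := {x : EuclideanSpace ℝ (Fin n) | 0 < x i}) (fun x hx => by
        rw [hvanish x (lt_of_le_of_lt (not_lt.1 hx) (by norm_num))]; simp),
    ← integral_indicator measurableSet_ball, ← integral_const_mul,
    ← integral_sub_right_eq_self (fun x => (4 ^ k)⁻¹ *
      (Metric.ball (0 : EuclideanSpace ℝ (Fin n)) (1 / 3)).indicator
        (fun x => (t + ‖x‖ ^ 2) ^ (-(2 * m))) x) e]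
  have hpow : Continuous fun x : EuclideanSpace ℝ (Fin n) => (t + ‖x‖ ^ 2) ^ (-(2 * m)) :=
    (by fun_prop : Continuous fun x : EuclideanSpace ℝ (Fin n) => t + ‖x‖ ^ 2).rpow_const
      fun x => Or.inl (by positivity)
  refine integral_mono ?_ ?_ fun x => ?_
  · refine Integrable.comp_sub_right (f := fun x => (4 ^ k)⁻¹ *
      (Metric.ball (0 : EuclideanSpace ℝ (Fin n)) (1 / 3)).indicator
        (fun x => (t + ‖x‖ ^ 2) ^ (-(2 * m))) x) (Integrable.const_mul ?_ _) e
    rw [integrable_indicator_iff measurableSet_ball]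
    exact (hpow.continuousOn.integrableOn_compact
      (isCompact_closedBall (0 : EuclideanSpace ℝ (Fin n)) (1 / 3))).mono_set
        Metric.ball_subset_closedBall
  · have hcompact : HasCompactSupport fun x => cutoffBubble m (t, ‖x - e‖ ^ 2) ^ 2 :=
      (cutoffBubble_hasCompactSupport m t e).comp_left (g := fun y : ℝ => y ^ 2) (by simp)
    have hsq : Integrable fun x => cutoffBubble m (t, ‖x - e‖ ^ 2) ^ 2 :=
      (hgc.pow 2).integrable_of_hasCompactSupport hcompact
    have hmeas : Measurable fun x : EuclideanSpace ℝ (Fin n) => x i ^ (2 * k) := by fun_prop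
    refine (hsq.const_mul (4 ^ k)).mono'
      ((hgc.measurable.pow_const 2).div hmeas).aestronglyMeasurable
      (Filter.Eventually.of_forall fun x => ?_)
    rcases lt_or_ge (x i) (1 / 2) with hx | hx
    · rw [hvanish x hx]; simp
    · rw [Real.norm_of_nonneg (div_nonneg (sq_nonneg _) (by positivity)),
        div_le_iff₀ (by positivity)]
      have h1 : 1 ≤ 4 ^ k * x i ^ (2 * k) := by
        rw [pow_mul, ← mul_pow]
        exact one_le_pow₀ (by nlinarith)
      nlinarith [sq_nonneg (cutoffBubble m (t, ‖x - e‖ ^ 2))]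
  · simp only
    by_cases hx : x - e ∈ Metric.ball (0 : EuclideanSpace ℝ (Fin n)) (1 / 3)
    · rw [Set.indicator_of_mem hx]
      rw [mem_ball_zero_iff] at hx
      have hr := abs_le.1 ((hcoord x).trans hx.le)
      have hx0 : 0 < x i := by linarith [hr.1]
      rw [cutoffBubble_eq m t (by nlinarith [norm_nonneg (x - e)]),
        ← Real.rpow_natCast ((t + ‖x - e‖ ^ 2) ^ (-m)) 2, ← Real.rpow_mul (by positivity),
        show -m * ((2 : ℕ) : ℝ) = -(2 * m) by push_cast; ring, div_eq_inv_mul]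
      refine mul_le_mul_of_nonneg_right ?_ (by positivity)
      refine inv_anti₀ (by positivity) ?_
      rw [pow_mul]
      exact pow_le_pow_left₀ (by positivity) (by nlinarith [hr.2]) k
    · rw [Set.indicator_of_notMem hx, mul_zero]
      rw [pow_mul]
      positivity

/-- Theorem 1.7 (1) of the paper (half-space form): if `2 ≤ k`, `4k ≤ n` and the
Hardy–Sobolev–Maz'ya inequality with the sharp Sobolev constant holds with Hardy
coefficient `-λ`, then `λ ≥ 0`. -/
theorem HSM_coefficient_nonneg (n k : ℕ) (hk : 2 ≤ k) (hn : 4 * k ≤ n) (lam : ℝ)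
    (h : ∀ g : EuclideanSpace ℝ (Fin n) → ℝ,
      ContDiff ℝ (⊤ : ℕ∞) g → HasCompactSupport g →
      tsupport g ⊆ {x : EuclideanSpace ℝ (Fin n) | 0 < x ⟨0, by omega⟩} →
      (∫ x in {x : EuclideanSpace ℝ (Fin n) | 0 < x ⟨0, by omega⟩},
          g x * negLapPow k g x)
        + lam * ∫ x in {x : EuclideanSpace ℝ (Fin n) | 0 < x ⟨0, by omega⟩},
            g x ^ 2 / (x ⟨0, by omega⟩) ^ (2 * k)
      ≥ (Real.Gamma (((n : ℝ) + 2 * k) / 2) / Real.Gamma (((n : ℝ) - 2 * k) / 2)) *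
          (2 * Real.pi ^ (((n : ℝ) + 1) / 2) / Real.Gamma (((n : ℝ) + 1) / 2))
            ^ ((2 * (k : ℝ)) / n) *
        (∫ x in {x : EuclideanSpace ℝ (Fin n) | 0 < x ⟨0, by omega⟩},
          |g x| ^ ((2 * (n : ℝ)) / ((n : ℝ) - 2 * k))) ^ (((n : ℝ) - 2 * k) / n)) :
    0 ≤ lam := by
  have hkn : 2 * k < n := by omega
  have hn0 : 0 < n := by omega
  have hn' : (0 : ℝ) < n := by exact_mod_cast hn0
  have hkn' : 2 * (k : ℝ) < n := by exact_mod_cast hkn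
  have hnk : 4 * (k : ℝ) ≤ n := by exact_mod_cast hn
  have hk0 : (0 : ℝ) ≤ k := k.cast_nonneg
  by_contra! hlam
  set i : Fin n := ⟨0, by omega⟩
  set e : EuclideanSpace ℝ (Fin n) := EuclideanSpace.single i 1 with he
  set m : ℝ := (n : ℝ) / 2 - k with hm
  set P : ℝ := Real.Gamma (((n : ℝ) + 2 * k) / 2) / Real.Gamma (((n : ℝ) - 2 * k) / 2) with hP
  have hPeq : bubbleCoeff n k = P := bubbleCoeff_eq_Gamma_div hkn
  have hP0 : 0 ≤ P := hPeq ▸ bubbleCoeff_nonneg hkn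
  obtain ⟨C, -, hC⟩ := exists_integral_cutoffBubble_mul_le hkn e
  set K : ℝ := 9 ^ (n : ℝ) * ∫ x : EuclideanSpace ℝ (Fin n), (1 + ‖x‖ ^ 2) ^ (-(n : ℝ)) with hK
  have hK0 : 0 ≤ K := mul_nonneg (by positivity) (integral_nonneg fun x => by positivity)
  obtain ⟨t, ht, ht1, hblow⟩ := exists_lt_setIntegral_add_norm_sq_rpow_neg hn0
    (a := 2 * m) (ρ := 1 / 3) (by linarith) (by norm_num) ((C + 4 ^ k * P * K) * 4 ^ k / (-lam))
  set g : EuclideanSpace ℝ (Fin n) → ℝ := fun x => cutoffBubble m (t, ‖x - e‖ ^ 2) with hg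
  have hvanish : ∀ x : EuclideanSpace ℝ (Fin n), x i < 1 / 2 → g x = 0 := fun x hx =>
    cutoffBubble_eq_zero_of_apply_lt i m t hx
  have hzero : ∀ x ∉ {x : EuclideanSpace ℝ (Fin n) | 0 < x i}, g x = 0 := fun x hx =>
    hvanish x (lt_of_le_of_lt (not_lt.1 hx) (by norm_num))
  have hsupp : tsupport g ⊆ {x : EuclideanSpace ℝ (Fin n) | 0 < x i} := by
    have hclosed : IsClosed {x : EuclideanSpace ℝ (Fin n) | 1 / 2 ≤ x i} :=
      isClosed_le continuous_const (by fun_prop)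
    refine (closure_minimal (fun x hx => ?_) hclosed).trans fun x (hx : 1 / 2 ≤ x i) => ?_
    · exact not_lt.1 fun hlt => hx (hvanish x hlt)
    · exact lt_of_lt_of_le (by norm_num) hx
  have hineq := h g ((contDiffOn_cutoffBubble m).comp_norm_sub_sq e ht)
    (cutoffBubble_hasCompactSupport m t e) hsupp
  have hpexp : (2 * (n : ℝ)) / ((n : ℝ) - 2 * k) ≠ 0 :=
    (div_pos (by linarith) (by linarith)).ne'
  rw [setIntegral_eq_integral_of_forall_compl_eq_zero (fun x hx => by rw [hzero x hx, zero_mul]),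
    setIntegral_eq_integral_of_forall_compl_eq_zero (f := fun x => |g x| ^ _) (fun x hx => by
      rw [hzero x hx, abs_zero, Real.zero_rpow hpexp])] at hineq
  have hE := hC t ht ht1
  rw [hPeq] at hE
  have hH := le_setIntegral_cutoffBubble_sq_div i k m ht
  have hN := le_integral_abs_cutoffBubble_rpow hkn e ht
  have hS := sobolevConst_mul_rpow (k := k) hn0 P ht
  set I : ℝ := ∫ x : EuclideanSpace ℝ (Fin n), (t + ‖x‖ ^ 2) ^ (-(n : ℝ)) with hI
  have hI0 : 0 < I := by
    rw [hI, integral_add_norm_sq_rpow_neg ht, integral_one_add_norm_sq_rpow_neg hn0]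
    have := Real.Gamma_pos_of_pos (show 0 < ((n : ℝ) + 1) / 2 by linarith)
    positivity
  have hNθ := sub_mul_rpow_le_rpow (θ := ((n : ℝ) - 2 * k) / n) hI0 hK0 hN
    (integral_nonneg fun x => by positivity) (div_nonneg (by linarith) hn'.le)
    ((div_le_one hn').2 (by linarith))
  set ω : ℝ := (2 * Real.pi ^ (((n : ℝ) + 1) / 2) / Real.Gamma (((n : ℝ) + 1) / 2))
    ^ ((2 * (k : ℝ)) / n) with hω
  have hω0 : 0 ≤ ω := by
    have := Real.Gamma_pos_of_pos (show 0 < ((n : ℝ) + 1) / 2 by linarith)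
    positivity
  have hSN := mul_le_mul_of_nonneg_left hNθ (mul_nonneg hP0 hω0)
  have hleft : P * ω * ((I - K) * I ^ (((n : ℝ) - 2 * k) / n - 1)) =
      4 ^ k * P * t ^ k * I - 4 ^ k * P * K * t ^ k := by
    rw [mul_comm (I - K), ← mul_assoc, hS]; ring
  rw [hleft] at hSN
  have htk : 4 ^ k * P * K * t ^ k ≤ 4 ^ k * P * K :=
    mul_le_of_le_one_right (by positivity) (pow_le_one₀ ht.le ht1)
  rw [div_lt_iff₀ (neg_pos.2 hlam)] at hblow
  have hHlam := mul_le_mul_of_nonpos_left hH hlam.le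
  set J : ℝ := ∫ x in Metric.ball (0 : EuclideanSpace ℝ (Fin n)) (1 / 3),
    (t + ‖x‖ ^ 2) ^ (-(2 * m))
  have hfour : (0 : ℝ) < 4 ^ k := by positivity
  have hupper : (C + 4 ^ k * P * K) * 4 ^ k ≥ J * -lam := by
    have : -lam * ((4 ^ k)⁻¹ * J) ≤ C + 4 ^ k * P * K := by linarith
    calc J * -lam = -lam * ((4 ^ k)⁻¹ * J) * 4 ^ k := by field_simp
      _ ≤ _ := mul_le_mul_of_nonneg_right this hfour.le
  linarith
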